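/- arXiv:0708.1116 — 2 statements merged into one kernel-verified Lean document; each statement's English description precedes it below -/
import Mathlib

section
/- Fix integers a ≥ 2, d ≥ 1, N ≥ 1, L ≥ 1 with N·L = a^d. If a configuration S' is reachable from a configuration S in the configuration graph (i.e., they lie in the same connected component), then S and S' induce the same partition of the vertex set into polymer supports: the family of vertex images of the N paths of S equals, as a set of subsets of V, the family of vertex images of the N paths of S'. In particular, if S and S' are adjacent and differ by the polymer C in S and C' in S', then C and C' occupy exactly the same set of vertices. -/
/-- Two vertices of the `d`-dimensional torus of side `a` are adjacent iff they agree in all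
but exactly one coordinate, in which they differ by `+1` or `-1` in `ZMod a`. -/
def torusAdj (a d : ℕ) (u v : Fin d → ZMod a) : Prop :=
  ∃ i : Fin d, (∀ j, j ≠ i → u j = v j) ∧ (v i = u i + 1 ∨ v i = u i - 1)

/-- A self-avoiding path of length `L` on the `d`-dimensional torus of side `a`. -/
structure SAPath (a d L : ℕ) where
  toFun : Fin L → (Fin d → ZMod a)
  inj : Function.Injective toFun
  adj : ∀ i : ℕ, ∀ h : i + 1 < L,
    torusAdj a d (toFun ⟨i, Nat.lt_of_succ_lt h⟩) (toFun ⟨i + 1, h⟩)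

/-- Two self-avoiding paths are identified if one is the reversal of the other. -/
def pathRel {a d L : ℕ} (p q : SAPath a d L) : Prop :=
  q.toFun = p.toFun ∨ q.toFun = p.toFun ∘ Fin.rev

instance polymerSetoid (a d L : ℕ) : Setoid (SAPath a d L) where
  r := pathRel
  iseqv := by
    constructor
    · intro p; exact Or.inl rfl
    · intro p q h
      rcases h with h | h
      · exact Or.inl h.symm
      · refine Or.inr ?_
        rw [h]
        funext i
        simp [Function.comp, Fin.rev_rev]
    · intro p q r h1 h2
      rcases h1 with h1 | h1 <;> rcases h2 with h2 | h2
      · exact Or.inl (h2.trans h1)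
      · exact Or.inr (by rw [h2, h1])
      · exact Or.inr (by rw [h2, h1])
      · refine Or.inl ?_
        rw [h2, h1]
        funext i
        simp [Function.comp, Fin.rev_rev]

/-- A polymer: a self-avoiding path up to reversal. -/
def Polymer (a d L : ℕ) := Quotient (polymerSetoid a d L)

noncomputable instance (a d L : ℕ) : DecidableEq (Polymer a d L) := Classical.decEq _

/-- The support of a polymer: the set of vertices it occupies. -/
def Polymer.support {a d L : ℕ} : Polymer a d L → Set (Fin d → ZMod a) :=
  Quotient.lift (fun p => Set.range p.toFun) (by
    intro p q h
    rcases h with h | h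
    · change Set.range p.toFun = Set.range q.toFun
      rw [h]
    · change Set.range p.toFun = Set.range q.toFun
      rw [h]
      exact ((Fin.rev_involutive).surjective.range_comp p.toFun).symm)

/-- A configuration of `N` polymers of length `L` on the `d`-dimensional torus of side `a`:
`N` self-avoiding paths (up to reversal) with pairwise disjoint supports. -/
structure Config (a d L N : ℕ) where
  polymers : Finset (Polymer a d L)
  card_eq : polymers.card = N
  disj : ∀ P ∈ polymers, ∀ Q ∈ polymers, P ≠ Q →
    Disjoint (Polymer.support P) (Polymer.support Q)

/-- The configuration graph: two configurations are adjacent iff they are distinct and their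
intersection contains exactly `N - 1` polymers. -/
noncomputable def configGraph (a d L N : ℕ) : SimpleGraph (Config a d L N) where
  Adj S S' := S ≠ S' ∧ (S.polymers ∩ S'.polymers).card = N - 1
  symm := by
    constructor
    intro S S' h
    exact ⟨h.1.symm, by rw [Finset.inter_comm]; exact h.2⟩
  loopless := by constructor; intro S h; exact h.1 rfl

theorem support_ncard_aux {a d L : ℕ} (P : Polymer a d L) : (Polymer.support P).ncard = L := by
  induction P using Quotient.inductionOn with
  | h p =>
    change (Set.range p.toFun).ncard = L
    rw [← Set.image_univ, Set.ncard_image_of_injective _ p.inj, Set.ncard_univ]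
    simp

theorem cover_aux {a d L N : ℕ} (ha : 2 ≤ a) (hfull : N * L = a ^ d) (S : Config a d L N)
    (v : Fin d → ZMod a) : ∃ P ∈ S.polymers, v ∈ Polymer.support P := by
  classical
  haveI : NeZero a := ⟨by omega⟩
  have hcard : (S.polymers.biUnion (fun P => (Polymer.support P).toFinset)).card = N * L := by
    rw [Finset.card_biUnion]
    · rw [Finset.sum_congr rfl (g := fun _ => L)]
      · simp [S.card_eq]
      · intro P _
        rw [← Set.ncard_eq_toFinset_card', support_ncard_aux]
    · intro P hP Q hQ hne
      rw [Function.onFun, Set.disjoint_toFinset]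
      exact S.disj P hP Q hQ hne
  have huniv : S.polymers.biUnion (fun P => (Polymer.support P).toFinset) = Finset.univ := by
    apply Finset.eq_univ_of_card
    rw [hcard, hfull]
    simp [ZMod.card]
  have := Finset.mem_univ v
  rw [← huniv] at this
  simpa using this

theorem adj_sub_aux {a d L N : ℕ} (ha : 2 ≤ a) (hN : 1 ≤ N) (hfull : N * L = a ^ d)
    (S S' : Config a d L N) (h : (configGraph a d L N).Adj S S') :
    ∃ C ∈ S.polymers, ∃ C' ∈ S'.polymers, C.support = C'.support ∧
      (∀ P ∈ S.polymers, P ≠ C → P ∈ S'.polymers) ∧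
      (∀ P ∈ S'.polymers, P ≠ C' → P ∈ S.polymers) := by
  obtain ⟨_, hc⟩ := h
  have h1 : (S.polymers \ S'.polymers).card = 1 := by
    have := Finset.card_sdiff_add_card_inter S.polymers S'.polymers
    have := S.card_eq
    omega
  have h2 : (S'.polymers \ S.polymers).card = 1 := by
    have := Finset.card_sdiff_add_card_inter S'.polymers S.polymers
    rw [Finset.inter_comm] at this
    have := S'.card_eq
    omega
  obtain ⟨C, hC⟩ := Finset.card_eq_one.1 h1
  obtain ⟨C', hC'⟩ := Finset.card_eq_one.1 h2
  have e1 : ∀ P, P ∈ S.polymers ∧ P ∉ S'.polymers ↔ P = C := fun P => by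
    rw [← Finset.mem_sdiff, hC, Finset.mem_singleton]
  have e2 : ∀ P, P ∈ S'.polymers ∧ P ∉ S.polymers ↔ P = C' := fun P => by
    rw [← Finset.mem_sdiff, hC', Finset.mem_singleton]
  have m1 := (e1 C).2 rfl
  have m2 := (e2 C').2 rfl
  have k1 : ∀ P ∈ S.polymers, P ≠ C → P ∈ S'.polymers := fun P hP hne => by
    by_contra hn
    exact hne ((e1 P).1 ⟨hP, hn⟩)
  have k2 : ∀ P ∈ S'.polymers, P ≠ C' → P ∈ S.polymers := fun P hP hne => by
    by_contra hn
    exact hne ((e2 P).1 ⟨hP, hn⟩)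
  refine ⟨C, m1.1, C', m2.1, ?_, k1, k2⟩
  apply Set.Subset.antisymm
  · intro v hv
    obtain ⟨P, hP, hvP⟩ := cover_aux ha hfull S' v
    by_cases hPC : P = C'
    · exact hPC ▸ hvP
    · have hne : P ≠ C := fun e => m1.2 (e ▸ hP)
      exact (Set.disjoint_left.1 (S.disj P (k2 P hP hPC) C m1.1 hne) hvP hv).elim
  · intro v hv
    obtain ⟨P, hP, hvP⟩ := cover_aux ha hfull S v
    by_cases hPC : P = C
    · exact hPC ▸ hvP
    · have hne : P ≠ C' := fun e => m2.2 (e ▸ hP)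
      exact (Set.disjoint_left.1 (S'.disj P (k1 P hP hPC) C' m2.1 hne) hvP hv).elim

theorem adj_eq_aux {a d L N : ℕ} (ha : 2 ≤ a) (hN : 1 ≤ N) (hfull : N * L = a ^ d)
    (S S' : Config a d L N) (h : (configGraph a d L N).Adj S S') :
    Polymer.support '' (S.polymers : Set (Polymer a d L)) =
      Polymer.support '' (S'.polymers : Set (Polymer a d L)) := by
  obtain ⟨C, hC, C', hC', he, k1, k2⟩ := adj_sub_aux ha hN hfull S S' h
  apply Set.Subset.antisymm
  · rintro _ ⟨P, hP, rfl⟩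
    by_cases hPC : P = C
    · exact ⟨C', hC', by rw [hPC, he]⟩
    · exact ⟨P, k1 P hP hPC, rfl⟩
  · rintro _ ⟨P, hP, rfl⟩
    by_cases hPC : P = C'
    · exact ⟨C, hC, by rw [hPC, he]⟩
    · exact ⟨P, k2 P hP hPC, rfl⟩

/-- at density one, reachable configurations induce the same partition of the
vertex set into polymer supports. -/
theorem reachable_same_supports_of_density_one
    (a d L N : ℕ) (ha : 2 ≤ a) (hd : 1 ≤ d) (hN : 1 ≤ N) (hL : 1 ≤ L)
    (hfull : N * L = a ^ d) (S S' : Config a d L N)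
    (h : (configGraph a d L N).Reachable S S') :
    Polymer.support '' (S.polymers : Set (Polymer a d L)) =
      Polymer.support '' (S'.polymers : Set (Polymer a d L)) := by
  obtain ⟨w⟩ := h
  induction w with
  | nil => rfl
  | cons hadj _ ih => exact (adj_eq_aux ha hN hfull _ _ hadj).trans ih
end

section
/- Let a ≥ 3 be an odd integer and set N = (a² − 1)/2. Then the configuration graph of N dimers on the two-dimensional torus of side a (so that exactly one vertex is free) is connected. -/
namespace DimerAux

structure NP {V : Type*} (A : V → V → Prop) (m : V → V) (h : V) : Prop where
  inv : ∀ x, m (m x) = x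
  fix : ∀ x, m x = x ↔ x = h
  adj : ∀ x, x ≠ h → A x (m x)

def move {V : Type*} [DecidableEq V] (m : V → V) (h v : V) : V → V :=
  fun x => if x = h then v else if x = v then h else if x = m v then m v else m x

def Step {V : Type*} [DecidableEq V] (A : V → V → Prop) (m m' : V → V) : Prop :=
  ∃ h v, NP A m h ∧ A h v ∧ m' = move m h v

def dis {V : Type*} [Fintype V] [DecidableEq V] (m m' : V → V) : Finset V :=
  Finset.univ.filter (fun x => m x ≠ m' x)

section abs
variable {V : Type*} [Fintype V] [DecidableEq V] {A : V → V → Prop}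

theorem NP.move (hs : ∀ x y, A x y → A y x) (hi : ∀ x, ¬ A x x) {m : V → V} {h v : V}
    (H : NP A m h) (hv : A h v) : NP A (move m h v) (m v) := by
  have hne : h ≠ v := fun e => hi v (e ▸ hv)
  have h1 := H.inv
  have h2 := H.fix
  have h3 := H.adj
  have h4 := hs _ _ hv
  have e1 := h2 h
  have e2 := h2 v
  have e3 := h1 v
  refine ⟨fun x => ?_, fun x => ?_, fun x hx => ?_⟩
  · have := h1 x
    have := h2 x
    unfold DimerAux.move; grind
  · have := h1 x
    have := h2 x
    unfold DimerAux.move; grind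
  · have := h3 x
    unfold DimerAux.move; grind

theorem step_symm (hs : ∀ x y, A x y → A y x) (hi : ∀ x, ¬ A x x) {m m' : V → V}
    (H : Step A m m') : Step A m' m := by
  obtain ⟨h, v, hm, hv, rfl⟩ := H
  have hne : h ≠ v := fun e => hi v (e ▸ hv)
  have h1 := hm.inv
  have h2 := hm.fix
  have h3 := hm.adj
  have e1 := h2 h
  have e2 := h2 v
  have e3 := h1 v
  refine ⟨m v, v, hm.move hs hi hv, hs _ _ (h3 v hne.symm), ?_⟩
  funext x
  have := h1 x
  have := h2 x
  unfold move; grind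

theorem dis_one {m m' : V → V} {h h' : V} (H : NP A m h) (H' : NP A m' h') (hh : h ≠ h') :
    (dis (move m h (m' h)) m').card + 2 ≤ (dis m m').card := by
  have h1 := H.inv
  have h2 := H.fix
  have h1' := H'.inv
  have h2' := H'.fix
  have e : ({h, m' h} : Finset V).card = 2 := Finset.card_pair (by grind)
  rw [← e, ← Finset.card_union_of_disjoint]
  · apply Finset.card_le_card
    intro x
    have := h1 x
    have := h2 x
    have := h1' x
    have := h2' x
    have := h1' h
    have := h2' h
    have := h1 h
    have := h2 h
    have := h1 (m' h)
    have := h2 (m' h)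
    simp only [dis, Finset.mem_union, Finset.mem_filter, Finset.mem_univ, true_and,
      Finset.mem_insert, Finset.mem_singleton]
    unfold move; grind
  · rw [Finset.disjoint_left]
    intro x
    have := h1' h
    simp only [dis, Finset.mem_filter, Finset.mem_univ, true_and,
      Finset.mem_insert, Finset.mem_singleton]
    unfold move; grind

theorem dis_two {m m' : V → V} {h v : V} (H : NP A m h) (H' : NP A m' h) (hv : m v ≠ m' v) :
    (dis (move m h v) m').card ≤ (dis m m').card + 1 := by
  refine le_trans (Finset.card_le_card ?_) (Finset.card_insert_le h (dis m m'))
  intro x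
  have h1 := H.inv
  have := h1 x
  have := h1 v
  have := H'.inv x
  simp only [dis, Finset.mem_filter, Finset.mem_univ, true_and, Finset.mem_insert]
  unfold move; grind

theorem dis_three {m m' : V → V} {h v : V} (H : NP A m h) (H' : NP A m' h) (hv : m v = m' v) :
    dis (move m h v) (move m' h v) = dis m m' := by
  ext x
  have := H.inv v
  have := H'.inv v
  have := (H.fix h).2 rfl
  have := (H'.fix h).2 rfl
  simp only [dis, Finset.mem_filter, Finset.mem_univ, true_and]
  unfold move; grind

theorem main_abs (hs : ∀ x y, A x y → A y x) (hi : ∀ x, ¬ A x x)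
    (ht : ∀ m h, NP A m h → ∀ x, ∃ n, NP A n x) :
    ∀ d : ℕ, ∀ m h m' h', NP A m h → NP A m' h' → (dis m m').card ≤ d →
      Relation.ReflTransGen (Step A) m m' := by
  have symm : ∀ m m', Relation.ReflTransGen (Step A) m m' → Relation.ReflTransGen (Step A) m' m := by
    intro m m' hr
    induction hr with
    | refl => exact .refl
    | tail _ h ih => exact .head (step_symm hs hi h) ih
  intro d
  induction d with
  | zero =>
    intro m h m' h' H H' hd
    have : m = m' := by
      funext x
      by_contra hx
      have : x ∈ dis m m' := by simp [dis, hx]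
      simp_all
    rw [this]
  | succ d ih =>
    intro m h m' h' H H' hd
    by_cases hh : h = h'
    · subst hh
      by_cases hE : m = m'
      · rw [hE]
      obtain ⟨x, hx⟩ := Function.ne_iff.1 hE
      obtain ⟨n, Hn⟩ := ht m h H x
      have inner : ∀ k : ℕ, ∀ m m' h, NP A m h → NP A m' h → (dis m m').card ≤ d + 1 →
          m x ≠ m' x → (dis m n).card ≤ k → Relation.ReflTransGen (Step A) m m' := by
        intro k
        induction k with
        | zero =>
          intro m m' h H H' hd hx hk
          have : m = n := by
            funext x
            by_contra hx
            have : x ∈ dis m n := by simp [dis, hx]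
            simp_all
          subst this
          have e := (H.fix x).1 ((Hn.fix x).2 rfl)
          subst e
          exact absurd (((H.fix x).2 rfl).trans ((H'.fix x).2 rfl).symm) hx
        | succ k ihk =>
          intro m m' h H H' hd hx hk
          have hhx : h ≠ x := by
            rintro rfl
            exact absurd (((H.fix h).2 rfl).trans ((H'.fix h).2 rfl).symm) hx
          have hA : A h (n h) := Hn.adj h hhx
          have hnv : n h ≠ h := fun e => hhx ((Hn.fix h).1 e)
          by_cases hv : m (n h) = m' (n h)
          · have d1 := dis_one H Hn hhx
            have d3 := dis_three H H' hv
            have M1 := H.move hs hi hA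
            have M2 := H'.move hs hi hA
            rw [← hv] at M2
            have r := ihk _ _ _ M1 M2 (by rw [d3]; exact hd) (by
              have : x ∈ dis m m' := by simp [dis, hx]
              rw [← d3] at this
              simpa [dis] using this) (by omega)
            have s1 : Step A m (move m h (n h)) := ⟨h, n h, H, hA, rfl⟩
            have s2 : Step A m' (move m' h (n h)) := ⟨h, n h, H', hA, rfl⟩
            exact (Relation.ReflTransGen.head s1 r).tail (step_symm hs hi s2)
          · have d2 := dis_two H H' hv
            have M1 := H.move hs hi hA
            have hw : m (n h) ≠ h := fun e => by
              have := H.inv (n h)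
              rw [e, (H.fix h).2 rfl] at this
              exact hnv this.symm
            have d1 := dis_one M1 H' hw
            have hA2 := H'.adj _ hw
            have M2 := M1.move hs hi hA2
            have r := ih _ _ _ _ M2 H' (by omega)
            exact .head ⟨_, _, H, hA, rfl⟩ (.head ⟨_, _, M1, hA2, rfl⟩ r)
      exact inner _ m m' h H H' hd hx le_rfl
    · have hA := H'.adj h hh
      have d1 := dis_one H H' hh
      exact .head ⟨h, _, H, hA, rfl⟩ (ih _ _ _ _ (H.move hs hi hA) H' (by omega))

end abs

theorem move_iff {V : Type*} [DecidableEq V] {A : V → V → Prop} {m : V → V} {h v : V}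
    (H : NP A m h) (hne : h ≠ v) (hvw : v ≠ m v) (hhw : h ≠ m v) (x y : V) (hxy : x ≠ y) :
    move m h v x = y ↔ ((h = x ∧ v = y ∨ h = y ∧ v = x) ∨
      m x = y ∧ ¬ (v = x ∧ m v = y ∨ v = y ∧ m v = x)) := by
  have h1 := H.inv x
  have h2 := H.inv v
  have h3 := H.fix x
  clear H
  unfold move
  grind

variable {a : ℕ}

theorem tadj_symm (x y : Fin 2 → ZMod a) (h : torusAdj a 2 x y) : torusAdj a 2 y x := by
  obtain ⟨i, h1, h2⟩ := h
  refine ⟨i, fun j hj => (h1 j hj).symm, ?_⟩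
  rcases h2 with h2 | h2
  · right; rw [h2]; ring
  · left; rw [h2]; ring

theorem tadj_irrefl (ha : 3 ≤ a) (x : Fin 2 → ZMod a) : ¬ torusAdj a 2 x x := by
  rintro ⟨i, -, h⟩
  haveI : Fact (1 < a) := ⟨by omega⟩
  have h1 : (1 : ZMod a) ≠ 0 := one_ne_zero
  rcases h with h | h
  · exact h1 (by simpa using h.symm)
  · exact h1 (by simpa using h.symm)

theorem tadj_add {x y : Fin 2 → ZMod a} (c : Fin 2 → ZMod a) (h : torusAdj a 2 x y) :
    torusAdj a 2 (x + c) (y + c) := by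
  obtain ⟨i, h1, h2⟩ := h
  refine ⟨i, fun j hj => by simp [h1 j hj], ?_⟩
  rcases h2 with h2 | h2
  · left; simp [h2]; ring
  · right; simp [h2]; ring

theorem np_trans (m : (Fin 2 → ZMod a) → (Fin 2 → ZMod a)) (h : Fin 2 → ZMod a)
    (H : NP (torusAdj a 2) m h) (x : Fin 2 → ZMod a) : ∃ n, NP (torusAdj a 2) n x := by
  refine ⟨fun y => m (y - (x - h)) + (x - h), fun y => ?_, fun y => ?_, fun y hy => ?_⟩
  · simp [H.inv]
  · rw [← eq_sub_iff_add_eq, H.fix, sub_eq_iff_eq_add]; simp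
  · have := tadj_add (x - h) (H.adj (y - (x - h)) (by
      rw [ne_eq, sub_eq_iff_eq_add]; simpa using hy))
    simpa using this

theorem supp_exists (P : Polymer a 2 2) :
    ∃ x y, x ≠ y ∧ torusAdj a 2 x y ∧ P.support = {x, y} := by
  induction P using Quotient.inductionOn with
  | _ p =>
    refine ⟨p.toFun 0, p.toFun 1, fun e => ?_, p.adj 0 (by norm_num), ?_⟩
    · have := p.inj e; simp at this
    · change Set.range p.toFun = _
      ext z; simp [Fin.exists_fin_two, eq_comm]

theorem supp_inj {P Q : Polymer a 2 2} (h : P.support = Q.support) : P = Q := by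
  induction P using Quotient.inductionOn with
  | _ p =>
  induction Q using Quotient.inductionOn with
  | _ q =>
    change Set.range p.toFun = Set.range q.toFun at h
    apply Quotient.sound
    change pathRel p q
    have hp : p.toFun 0 ≠ p.toFun 1 := fun e => by have := p.inj e; simp at this
    have hq : q.toFun 0 ≠ q.toFun 1 := fun e => by have := q.inj e; simp at this
    have h0 : q.toFun 0 ∈ Set.range p.toFun := h ▸ ⟨0, rfl⟩
    have h1 : q.toFun 1 ∈ Set.range p.toFun := h ▸ ⟨1, rfl⟩
    simp only [Set.mem_range, Fin.exists_fin_two] at h0 h1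
    rcases h0 with h0 | h0 <;> rcases h1 with h1 | h1
    · exact absurd (h0.symm.trans h1) hq
    · left; funext i; fin_cases i
      · exact h0.symm
      · exact h1.symm
    · right; funext i; fin_cases i
      · exact h0.symm
      · exact h1.symm
    · exact absurd (h0.symm.trans h1) hq

theorem exists_poly {x y : Fin 2 → ZMod a} (hne : x ≠ y) (h : torusAdj a 2 x y) :
    ∃ P : Polymer a 2 2, P.support = {x, y} := by
  refine ⟨Quotient.mk _ ⟨![x, y], ?_, ?_⟩, ?_⟩
  · intro i j hij
    fin_cases i <;> fin_cases j <;> simp_all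
  · intro i hi
    obtain rfl : i = 0 := by omega
    exact h
  · change Set.range ![x, y] = _
    simp [Matrix.range_cons, Set.pair_comm]

def Rep {N : ℕ} (S : Config a 2 2 N) (m : (Fin 2 → ZMod a) → (Fin 2 → ZMod a)) : Prop :=
  ∀ x y, x ≠ y → (m x = y ↔ ∃ P ∈ S.polymers, P.support = {x, y})

theorem rep_unique {N : ℕ} {S S' : Config a 2 2 N} {m : (Fin 2 → ZMod a) → (Fin 2 → ZMod a)}
    (h : Rep S m) (h' : Rep S' m) : S = S' := by
  have key : ∀ {S S' : Config a 2 2 N}, Rep S m → Rep S' m → S.polymers ⊆ S'.polymers := by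
    intro S S' h h' P hP
    obtain ⟨x, y, hne, -, hs⟩ := supp_exists P
    obtain ⟨Q, hQ, hs'⟩ := (h' x y hne).1 ((h x y hne).2 ⟨P, hP, hs⟩)
    rwa [supp_inj (hs.trans hs'.symm)]
  have : S.polymers = S'.polymers := Finset.Subset.antisymm (key h h') (key h' h)
  cases S; cases S'; simp_all

theorem same_poly {N : ℕ} (S : Config a 2 2 N) {P Q : Polymer a 2 2} (hP : P ∈ S.polymers)
    (hQ : Q ∈ S.polymers) {x : Fin 2 → ZMod a} (h1 : x ∈ P.support) (h2 : x ∈ Q.support) :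
    P = Q := by
  by_contra hne
  exact Set.disjoint_left.1 (S.disj P hP Q hQ hne) h1 h2

theorem rep_exists {N : ℕ} (ha : 3 ≤ a) (hN : 2 * N = a ^ 2 - 1) (S : Config a 2 2 N) :
    ∃ m h, NP (torusAdj a 2) m h ∧ Rep S m := by
  classical
  haveI : NeZero a := ⟨by omega⟩
  have hex : ∀ x : Fin 2 → ZMod a, ∃ z, (∀ y, x ≠ y →
      (z = y ↔ ∃ P ∈ S.polymers, P.support = {x, y})) ∧
      (z = x ↔ ∀ P ∈ S.polymers, x ∉ P.support) := by
    intro x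
    by_cases hx : ∃ P ∈ S.polymers, x ∈ P.support
    · obtain ⟨P, hP, hxP⟩ := hx
      have : ∃ z, x ≠ z ∧ P.support = {x, z} := by
        obtain ⟨u, v, hne, -, hs⟩ := supp_exists P
        rw [hs] at hxP
        rcases hxP with rfl | hxP
        · exact ⟨v, hne, hs⟩
        · rw [Set.mem_singleton_iff] at hxP
          subst hxP
          exact ⟨u, hne.symm, by rw [hs, Set.pair_comm]⟩
      obtain ⟨z, hxz, hs⟩ := this
      refine ⟨z, fun y hy => ⟨fun e => ⟨P, hP, e ▸ hs⟩, ?_⟩, ?_⟩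
      · rintro ⟨Q, hQ, hsQ⟩
        have := same_poly S hP hQ hxP (by simp [hsQ])
        subst this
        have : z ∈ ({x, y} : Set _) := by rw [← hsQ, hs]; simp
        rcases this with e | e
        · exact absurd e.symm hxz
        · exact e
      · constructor
        · intro e; exact absurd e.symm hxz
        · intro e; exact absurd hxP (e P hP)
    · push Not at hx
      refine ⟨x, fun y hy => ⟨fun e => absurd e hy, ?_⟩, ?_⟩
      · rintro ⟨P, hP, hs⟩
        exact absurd (show x ∈ P.support by simp [hs]) (hx P hP)
      · simpa using hx
  choose m hm hf using hex
  have hcard : (S.polymers.biUnion (fun P => P.support.toFinset)).card = 2 * N := by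
    rw [Finset.card_biUnion]
    · rw [Finset.sum_const_nat (m := 2), S.card_eq, mul_comm]
      intro P hP
      obtain ⟨x, y, hne, -, hs⟩ := supp_exists P
      have : P.support.toFinset = {x, y} := by ext z; simp [hs]
      rw [this, Finset.card_pair hne]
    · intro P hP Q hQ hne
      rw [Function.onFun, Set.disjoint_toFinset]
      exact S.disj P hP Q hQ hne
  have hc1 : (S.polymers.biUnion (fun P => P.support.toFinset))ᶜ.card = 1 := by
    rw [Finset.card_compl, hcard, hN]
    simp only [Fintype.card_pi, ZMod.card, Finset.prod_const, Finset.card_univ, Fintype.card_fin]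
    have : 0 < a ^ 2 := by positivity
    omega
  obtain ⟨h, hh⟩ := Finset.card_eq_one.1 hc1
  have hfix : ∀ x, m x = x ↔ x = h := by
    intro x
    rw [hf, ← Finset.mem_singleton, ← hh]
    simp
  refine ⟨m, h, ⟨fun x => ?_, hfix, fun x hx => ?_⟩, fun x y hne => hm x y hne⟩
  · by_cases hx : m x = x
    · rw [hx, hx]
    · obtain ⟨P, hP, hs⟩ := (hm x (m x) (Ne.symm hx)).1 rfl
      exact (hm (m x) x hx).2 ⟨P, hP, by rw [hs, Set.pair_comm]⟩
  · have hx : m x ≠ x := fun e => hx ((hfix x).1 e)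
    obtain ⟨P, hP, hs⟩ := (hm x (m x) (Ne.symm hx)).1 rfl
    obtain ⟨u, v, hne, hA, hs'⟩ := supp_exists P
    rw [hs] at hs'
    rcases Set.pair_eq_pair_iff.1 hs' with ⟨e1, e2⟩ | ⟨e1, e2⟩
    · rw [e2, e1]; exact hA
    · rw [e2, e1]; exact tadj_symm _ _ hA

theorem rep_step {N : ℕ} (ha : 3 ≤ a) {S : Config a 2 2 N}
    {m m' : (Fin 2 → ZMod a) → (Fin 2 → ZMod a)}
    (hr : Rep S m) (hst : Step (torusAdj a 2) m m') :
    ∃ S' : Config a 2 2 N, (configGraph a 2 2 N).Adj S S' ∧ Rep S' m' := by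
  classical
  obtain ⟨h, v, H, hA, rfl⟩ := hst
  have hne : h ≠ v := fun e => tadj_irrefl ha v (e ▸ hA)
  have hvw : v ≠ m v := fun e => hne ((H.fix v).1 e.symm).symm
  have hmh := (H.fix h).2 rfl
  have hhw : h ≠ m v := fun e => hne (by rw [← H.inv v, ← e, hmh])
  obtain ⟨P, hP, hPs⟩ := (hr v (m v) hvw).1 rfl
  obtain ⟨Q, hQs⟩ := exists_poly hne hA
  -- hole is uncovered
  have hunc : ∀ R ∈ S.polymers, h ∉ R.support := by
    intro R hR hmem
    obtain ⟨x, y, hxy, -, hs⟩ := supp_exists R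
    rw [hs] at hmem
    rcases hmem with e | e
    · subst e
      exact hxy (((H.fix h).2 rfl).symm.trans ((hr h y hxy).2 ⟨R, hR, hs⟩))
    · rw [Set.mem_singleton_iff] at e
      subst e
      exact hxy.symm (((H.fix h).2 rfl).symm.trans
        ((hr h x hxy.symm).2 ⟨R, hR, by rw [hs, Set.pair_comm]⟩))
  have hQS : Q ∉ S.polymers := fun hQ => hunc Q hQ (by simp [hQs])
  have hQd : ∀ R ∈ S.polymers.erase P, Disjoint Q.support R.support := by
    intro R hR
    rw [Finset.mem_erase] at hR
    rw [Set.disjoint_left]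
    intro z hz hz'
    rw [hQs] at hz
    rcases hz with e | e
    · exact hunc R hR.2 (e ▸ hz')
    · rw [Set.mem_singleton_iff] at e
      subst e
      exact hR.1 (same_poly S hR.2 hP hz' (by simp [hPs]))
  have hQE : Q ∉ S.polymers.erase P := fun hh => hQS (Finset.mem_of_mem_erase hh)
  have hpos : 0 < S.polymers.card := Finset.card_pos.2 ⟨P, hP⟩
  let S' : Config a 2 2 N :=
    { polymers := insert Q (S.polymers.erase P)
      card_eq := by
        rw [Finset.card_insert_of_notMem hQE, Finset.card_erase_of_mem hP]
        have := S.card_eq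
        omega
      disj := by
        intro R hR T hT hRT
        rw [Finset.mem_insert] at hR hT
        rcases hR with rfl | hR <;> rcases hT with rfl | hT
        · exact absurd rfl hRT
        · exact hQd T hT
        · exact (hQd R hR).symm
        · exact S.disj R (Finset.mem_of_mem_erase hR) T (Finset.mem_of_mem_erase hT) hRT }
  refine ⟨S', ⟨fun e => hQS ?_, ?_⟩, ?_⟩
  · rw [e]; exact Finset.mem_insert_self _ _
  · have : S.polymers ∩ S'.polymers = S.polymers.erase P := by
      ext R
      simp only [S', Finset.mem_inter, Finset.mem_insert, Finset.mem_erase]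
      grind
    have h2 : (S.polymers ∩ S'.polymers).card = N - 1 := by
      rw [this, Finset.card_erase_of_mem hP, S.card_eq]
    convert h2
  · intro x y hxy
    have e1 : (∃ R ∈ S'.polymers, R.support = {x, y}) ↔
        (({h, v} : Set (Fin 2 → ZMod a)) = {x, y} ∨
          (m x = y ∧ ({v, m v} : Set (Fin 2 → ZMod a)) ≠ {x, y})) := by
      rw [hr x y hxy]
      constructor
      · rintro ⟨R, hR, hs⟩
        rcases Finset.mem_insert.1 hR with rfl | hR
        · left; rw [← hs, hQs]
        · right
          rw [Finset.mem_erase] at hR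
          refine ⟨⟨R, hR.2, hs⟩, fun e => hR.1 (supp_inj ?_)⟩
          rw [hs, hPs, e]
      · rintro (e | ⟨⟨R, hR, hs⟩, e⟩)
        · exact ⟨Q, Finset.mem_insert_self _ _, hQs.trans e⟩
        · refine ⟨R, Finset.mem_insert_of_mem (Finset.mem_erase.2 ⟨?_, hR⟩), hs⟩
          rintro rfl
          exact e (hPs.symm.trans hs)
    rw [e1, ne_eq, Set.pair_eq_pair_iff, Set.pair_eq_pair_iff]
    exact move_iff H hne hvw hhw x y hxy

end DimerAux

open DimerAux in
/-- for odd `a ≥ 3` and `N = (a² - 1)/2` (exactly one free vertex), the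
configuration graph of `N` dimers on the two-dimensional torus of side `a` is connected. -/
theorem dimer_configGraph_preconnected_one_hole
    (a N : ℕ) (ha : 3 ≤ a) (hodd : Odd a) (hN : 2 * N = a ^ 2 - 1) :
    (configGraph a 2 2 N).Preconnected := by
  classical
  haveI : NeZero a := ⟨by omega⟩
  intro S T
  obtain ⟨m, h, H, hr⟩ := rep_exists ha hN S
  obtain ⟨m', h', H', hr'⟩ := rep_exists ha hN T
  have key := main_abs (A := torusAdj a 2) tadj_symm (tadj_irrefl ha) np_trans _ m h m' h' H H' le_rfl
  have : ∀ n, Relation.ReflTransGen (Step (torusAdj a 2)) m n →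
      ∃ S', (configGraph a 2 2 N).Reachable S S' ∧ Rep S' n := by
    intro n hn
    induction hn with
    | refl => exact ⟨S, .refl _, hr⟩
    | tail _ hst ih =>
      obtain ⟨S1, h1, h2⟩ := ih
      obtain ⟨S2, h3, h4⟩ := rep_step ha h2 hst
      exact ⟨S2, h1.trans h3.reachable, h4⟩
  obtain ⟨S', h1, h2⟩ := this m' key
  rwa [rep_unique hr' h2]
end
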